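/- Let A ∈ ℝ^{m×n}, b ∈ ℝ^m, λ > 0, γ ∈ (0,1), α ∈ (0,1), and let μ ≥ 0 be such that ⟨Av, Av⟩ ≥ μ‖v‖₂² for all v ∈ ℝ^n. Define g(x) = (1/2)‖Ax − b‖₂² + λγ‖x‖₁ + (3λ(1−γ)/2)‖x‖₂², h(x) = λ(αγ‖x‖₂ + ((1−γ)/2)‖x‖₂²), H(x) = g(x) − h(x), and μ_g = μ + 3λ(1−γ). Let x_k, x_{k+1} ∈ ℝ^n satisfy the DCA update: if x_k = 0 then x_{k+1} is a global minimizer of g over ℝ^n, and if x_k ≠ 0 then x_{k+1} is a global minimizer over ℝ^n of x ↦ g(x) − λ⟨x, d(x_k)⟩, where d(x_k) = (αγ/‖x_k‖₂ + 1 − γ)·x_k. Then H(x_k) − H(x_{k+1}) ≥ (μ_g/2)·‖x_k − x_{k+1}‖₂². -/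

import Mathlib

/-- The ℓ¹-norm of a vector in ℝ^n. -/
noncomputable def norm1 {n : ℕ} (x : Fin n → ℝ) : ℝ := ∑ i, |x i|

/-- The Euclidean (ℓ²) norm of a vector in ℝ^n. -/
noncomputable def norm2 {n : ℕ} (x : Fin n → ℝ) : ℝ := Real.sqrt (∑ i, (x i) ^ 2)

/-- The convex part g(x) = (1/2)‖Ax − b‖₂² + λγ‖x‖₁ + (3λ(1−γ)/2)‖x‖₂². -/
noncomputable def gDC {m n : ℕ} (A : Matrix (Fin m) (Fin n) ℝ) (b : Fin m → ℝ)
    (lam γ : ℝ) (x : Fin n → ℝ) : ℝ :=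
  (1 / 2) * (norm2 (A.mulVec x - b)) ^ 2 + lam * γ * norm1 x
    + (3 * lam * (1 - γ) / 2) * (norm2 x) ^ 2

/-- The concave part h(x) = λ(αγ‖x‖₂ + ((1−γ)/2)‖x‖₂²). -/
noncomputable def hDC {n : ℕ} (lam γ α : ℝ) (x : Fin n → ℝ) : ℝ :=
  lam * (α * γ * norm2 x + ((1 - γ) / 2) * (norm2 x) ^ 2)

lemma norm2_nonneg {n : ℕ} (x : Fin n → ℝ) : 0 ≤ norm2 x := Real.sqrt_nonneg _

lemma norm2_sq {n : ℕ} (x : Fin n → ℝ) : norm2 x ^ 2 = ∑ i, x i ^ 2 :=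
  Real.sq_sqrt (Finset.sum_nonneg fun _ _ => sq_nonneg _)

lemma norm2_pos {n : ℕ} {x : Fin n → ℝ} (hx : x ≠ 0) : 0 < norm2 x := by
  obtain ⟨i, hi⟩ := Function.ne_iff.mp hx
  exact Real.sqrt_pos.mpr (Finset.sum_pos' (fun _ _ => sq_nonneg _)
    ⟨i, Finset.mem_univ i, pow_pos (abs_pos.mpr hi) 2 |>.trans_eq (sq_abs _)⟩)

lemma sum_mul_le_norm2_mul_norm2 {n : ℕ} (x y : Fin n → ℝ) :
    ∑ i, x i * y i ≤ norm2 x * norm2 y :=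
  Real.sum_mul_le_sqrt_mul_sqrt _ x y

lemma norm2_sq_segment {n : ℕ} (x y : Fin n → ℝ) (t : ℝ) :
    norm2 ((1 - t) • x + t • y) ^ 2
      = (1 - t) * norm2 x ^ 2 + t * norm2 y ^ 2 - t * (1 - t) * norm2 (y - x) ^ 2 := by
  simp only [norm2_sq, Finset.mul_sum, ← Finset.sum_add_distrib, ← Finset.sum_sub_distrib]
  refine Finset.sum_congr rfl fun i _ => ?_
  simp only [Pi.add_apply, Pi.smul_apply, Pi.sub_apply, smul_eq_mul]
  ring

lemma norm1_segment_le {n : ℕ} (x y : Fin n → ℝ) {t : ℝ} (ht : 0 ≤ t) (ht1 : t ≤ 1) :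
    norm1 ((1 - t) • x + t • y) ≤ (1 - t) * norm1 x + t * norm1 y := by
  simp only [norm1, Finset.mul_sum, ← Finset.sum_add_distrib]
  refine Finset.sum_le_sum fun i _ => ?_
  simp only [Pi.add_apply, Pi.smul_apply, smul_eq_mul]
  refine (abs_add_le _ _).trans_eq ?_
  rw [abs_mul, abs_mul, abs_of_nonneg ht, abs_of_nonneg (sub_nonneg.mpr ht1)]

/-- Strong convexity of `gDC` with modulus `μ + 3λ(1 - γ)`. -/
lemma gDC_segment_le {m n : ℕ} (A : Matrix (Fin m) (Fin n) ℝ) (b : Fin m → ℝ)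
    {lam γ μ : ℝ} (hlam : 0 ≤ lam) (hγ : 0 ≤ γ)
    (hA : ∀ v : Fin n → ℝ, μ * ∑ i, (v i) ^ 2 ≤ ∑ i, (A.mulVec v i) ^ 2)
    (x y : Fin n → ℝ) {t : ℝ} (ht : 0 ≤ t) (ht1 : t ≤ 1) :
    gDC A b lam γ ((1 - t) • x + t • y)
      ≤ (1 - t) * gDC A b lam γ x + t * gDC A b lam γ y
        - t * (1 - t) * ((μ + 3 * lam * (1 - γ)) / 2 * norm2 (y - x) ^ 2) := by
  have hres : A.mulVec ((1 - t) • x + t • y) - b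
      = (1 - t) • (A.mulVec x - b) + t • (A.mulVec y - b) := by
    rw [Matrix.mulVec_add, Matrix.mulVec_smul, Matrix.mulVec_smul]
    module
  have hdiff : A.mulVec y - b - (A.mulVec x - b) = A.mulVec (y - x) := by
    rw [Matrix.mulVec_sub]
    abel
  have hlower : μ * norm2 (y - x) ^ 2 ≤ norm2 (A.mulVec (y - x)) ^ 2 := by
    simpa only [norm2_sq] using hA (y - x)
  have h₁ := mul_le_mul_of_nonneg_left (norm1_segment_le x y ht ht1) (mul_nonneg hlam hγ)
  have h₂ := mul_le_mul_of_nonneg_left hlower (mul_nonneg ht (sub_nonneg.mpr ht1))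
  simp only [gDC]
  rw [hres, norm2_sq_segment, hdiff, norm2_sq_segment]
  linarith

/-- Quadratic growth of a linear perturbation of `gDC` around its minimizer. -/
lemma gDC_sub_linear_growth {m n : ℕ} (A : Matrix (Fin m) (Fin n) ℝ) (b : Fin m → ℝ)
    {lam γ μ : ℝ} (hlam : 0 ≤ lam) (hγ : 0 ≤ γ)
    (hA : ∀ v : Fin n → ℝ, μ * ∑ i, (v i) ^ 2 ≤ ∑ i, (A.mulVec v i) ^ 2)
    (d x : Fin n → ℝ)
    (hmin : ∀ z : Fin n → ℝ, gDC A b lam γ x - lam * ∑ i, x i * d i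
      ≤ gDC A b lam γ z - lam * ∑ i, z i * d i) (y : Fin n → ℝ) :
    (μ + 3 * lam * (1 - γ)) / 2 * norm2 (y - x) ^ 2
      ≤ (gDC A b lam γ y - lam * ∑ i, y i * d i)
        - (gDC A b lam γ x - lam * ∑ i, x i * d i) := by
  set C := (μ + 3 * lam * (1 - γ)) / 2 * norm2 (y - x) ^ 2 with hC
  set Δ := (gDC A b lam γ y - lam * ∑ i, y i * d i)
    - (gDC A b lam γ x - lam * ∑ i, x i * d i) with hΔ
  have hstep : ∀ t ∈ Set.Ioo (0 : ℝ) 1, (1 - t) * C ≤ Δ := by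
    rintro t ⟨ht, ht1⟩
    have hconv := gDC_segment_le A b hlam hγ hA x y ht.le ht1.le
    have hm := hmin ((1 - t) • x + t • y)
    have hlin : ∑ i, ((1 - t) • x + t • y) i * d i
        = (1 - t) * ∑ i, x i * d i + t * ∑ i, y i * d i := by
      simp only [Finset.mul_sum, ← Finset.sum_add_distrib]
      refine Finset.sum_congr rfl fun i _ => ?_
      simp only [Pi.add_apply, Pi.smul_apply, smul_eq_mul]
      ring
    rw [hlin] at hm
    rw [← hC] at hconv
    refine le_of_mul_le_mul_left ?_ ht
    rw [hΔ]
    linarith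
  have hlim : Filter.Tendsto (fun t : ℝ => (1 - t) * C) (nhdsWithin 0 (Set.Ioi 0)) (nhds C) := by
    have hcont : Continuous fun t : ℝ => (1 - t) * C := by fun_prop
    simpa using (hcont.tendsto 0).mono_left nhdsWithin_le_nhds
  exact le_of_tendsto hlim
    (Filter.mem_of_superset (Ioo_mem_nhdsGT one_pos) hstep)

/-- The subgradient inequality for `hDC` at a nonzero point. -/
lemma hDC_subgradient {n : ℕ} {lam γ α : ℝ} (hlam : 0 ≤ lam) (hγ : 0 ≤ γ) (hγ1 : γ ≤ 1)
    (hα : 0 ≤ α) {x : Fin n → ℝ} (hx : x ≠ 0) (y : Fin n → ℝ) :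
    lam * ∑ i, y i * ((α * γ / norm2 x + 1 - γ) * x i)
        - lam * ∑ i, x i * ((α * γ / norm2 x + 1 - γ) * x i)
      ≤ hDC lam γ α y - hDC lam γ α x := by
  have hN := norm2_pos hx
  have hCS := sum_mul_le_norm2_mul_norm2 y x
  have hpull : ∀ z : Fin n → ℝ, ∑ i, z i * ((α * γ / norm2 x + 1 - γ) * x i)
      = (α * γ / norm2 x + 1 - γ) * ∑ i, z i * x i := fun z => by
    rw [Finset.mul_sum]
    exact Finset.sum_congr rfl fun i _ => by ring
  have hself : ∑ i, x i * x i = norm2 x ^ 2 := by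
    rw [norm2_sq]
    exact Finset.sum_congr rfl fun i _ => by ring
  rw [hpull, hpull, hself]
  simp only [hDC]
  set P := ∑ i, y i * x i
  set N := norm2 x
  set M := norm2 y
  have hdiv : P / N ≤ M := (div_le_iff₀ hN).mpr hCS
  have h₁ : 0 ≤ lam * (α * γ) * (M - P / N) :=
    mul_nonneg (mul_nonneg hlam (mul_nonneg hα hγ)) (sub_nonneg.mpr hdiv)
  have h₂ : 0 ≤ lam * (1 - γ) * ((M ^ 2 + N ^ 2 - 2 * P) / 2) :=
    mul_nonneg (mul_nonneg hlam (sub_nonneg.mpr hγ1)) (by nlinarith [sq_nonneg (M - N)])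
  have hid : lam * (α * γ * M + (1 - γ) / 2 * M ^ 2) - lam * (α * γ * N + (1 - γ) / 2 * N ^ 2)
      - (lam * ((α * γ / N + 1 - γ) * P) - lam * ((α * γ / N + 1 - γ) * N ^ 2))
      = lam * (α * γ) * (M - P / N) + lam * (1 - γ) * ((M ^ 2 + N ^ 2 - 2 * P) / 2) := by
    field_simp
    ring
  linarith

/-- sufficient descent of the DCA iteration: with
  H = g − h, μ_g = μ + 3λ(1−γ), and the DCA update producing x_{k+1} from x_k,
  one has H(x_k) − H(x_{k+1}) ≥ (μ_g/2)‖x_k − x_{k+1}‖₂². -/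
theorem stmt19 {m n : ℕ} (A : Matrix (Fin m) (Fin n) ℝ) (b : Fin m → ℝ)
    (lam γ α μ : ℝ) (hlam : 0 < lam) (hγ : 0 < γ) (hγ1 : γ < 1)
    (hα : 0 < α) (hα1 : α < 1) (hμ : 0 ≤ μ)
    (hA : ∀ v : Fin n → ℝ, μ * ∑ i, (v i) ^ 2 ≤ ∑ i, (A.mulVec v i) ^ 2)
    (xk xk1 : Fin n → ℝ)
    (hzero : xk = 0 → ∀ x : Fin n → ℝ, gDC A b lam γ xk1 ≤ gDC A b lam γ x)
    (hnonzero : xk ≠ 0 →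
      ∀ x : Fin n → ℝ,
        gDC A b lam γ xk1
            - lam * ∑ i, xk1 i * ((α * γ / norm2 xk + 1 - γ) * xk i)
          ≤ gDC A b lam γ x
            - lam * ∑ i, x i * ((α * γ / norm2 xk + 1 - γ) * xk i)) :
    (gDC A b lam γ xk - hDC lam γ α xk) - (gDC A b lam γ xk1 - hDC lam γ α xk1)
      ≥ ((μ + 3 * lam * (1 - γ)) / 2) * (norm2 (xk - xk1)) ^ 2 := by
  by_cases hx : xk = 0
  · have hgrow := gDC_sub_linear_growth A b hlam.le hγ.le hA 0 xk1
      (by simpa using hzero hx) xk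
    have hh : hDC lam γ α xk = 0 := by simp [hDC, norm2, hx]
    have hh1 : 0 ≤ hDC lam γ α xk1 := by
      have := norm2_nonneg xk1
      have := sub_nonneg.mpr hγ1.le
      unfold hDC
      positivity
    simp only [Pi.zero_apply, mul_zero, Finset.sum_const_zero, sub_zero] at hgrow
    linarith
  · have hgrow := gDC_sub_linear_growth A b hlam.le hγ.le hA
      (fun i => (α * γ / norm2 xk + 1 - γ) * xk i) xk1 (hnonzero hx) xk
    have hsub := hDC_subgradient hlam.le hγ.le hγ1.le hα.le hx xk1
    linarith
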